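/- arXiv:2602.01476 — 2 statements merged into one kernel-verified Lean document; each statement's English description precedes it below -/
import Mathlib

section
/- Let g : [0,∞) → [0,∞) be nonincreasing and right-continuous with g(t) → 0 as t → ∞, and let ĝ : [0,∞) → [0,∞) be lower semicontinuous with ĝ(t) → 0 as t → ∞. Fix ε > 0 and k > 0. Let t* = g⁻¹(ε) (finite since g → 0 and ε > 0), and suppose k < min_{0 ≤ s ≤ t*} ĝ(s) (the minimum is attained since ĝ is lower semicontinuous). Then the stopping time τ̂_k = inf{t ≥ 0 : ĝ(t) ≤ k} is finite and satisfies g(τ̂_k) ≤ ε. -/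
/-- A function that is antitone and right-continuous on `[0,∞)` is at most `ε` at the infimum of
its sublevel set `{t ≥ 0 : g t ≤ ε}`, provided the latter is nonempty. -/
theorem AntitoneOn.apply_sInf_sublevel_le {g : ℝ → ℝ} {ε : ℝ}
    (hg : AntitoneOn g (Set.Ici 0))
    (hrc : ∀ t, 0 ≤ t → ContinuousWithinAt g (Set.Ici t) t)
    (hne : {t : ℝ | 0 ≤ t ∧ g t ≤ ε}.Nonempty) :
    g (sInf {t : ℝ | 0 ≤ t ∧ g t ≤ ε}) ≤ ε := by
  set T := sInf {t : ℝ | 0 ≤ t ∧ g t ≤ ε} with hT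
  have hT0 : 0 ≤ T := le_csInf hne fun t ht => ht.1
  refine le_of_tendsto ((hrc T hT0).mono Set.Ioi_subset_Ici_self) ?_
  filter_upwards [self_mem_nhdsWithin] with t ht
  obtain ⟨s, ⟨hs0, hs⟩, hst⟩ := exists_lt_of_csInf_lt hne ht
  exact (hg hs0 (hs0.trans hst.le) hst.le).trans hs

/-- A function tending to `0` at infinity has nonempty sublevel sets on `[0,∞)` at every
positive level. -/
theorem Filter.Tendsto.nonempty_sublevel {f : ℝ → ℝ} {c : ℝ}
    (hf : Filter.Tendsto f Filter.atTop (nhds 0)) (hc : 0 < c) :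
    {t : ℝ | 0 ≤ t ∧ f t ≤ c}.Nonempty :=
  ((Filter.eventually_ge_atTop 0).and (hf.eventually_le_const hc)).exists


/-- **Validity of the learned stopping time for a fixed instance.**
Let `g : [0,∞) → [0,∞)` be nonincreasing and right-continuous with `g t → 0` as `t → ∞`
(the true optimality gap), and let `gh : [0,∞) → [0,∞)` be lower semicontinuous with
`gh t → 0` as `t → ∞` (the predictor); both are modeled as functions `ℝ → ℝ` with the
hypotheses imposed on `[0,∞)`.  Fix `ε > 0` and `k > 0`, let `t* = g⁻¹(ε) =
inf {t ≥ 0 : g t ≤ ε}`, and suppose `k < min_{0 ≤ s ≤ t*} gh s`.  Then the stopping time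
`τ̂_k = inf {t ≥ 0 : gh t ≤ k}` is finite (the defining set is nonempty) and satisfies
`g τ̂_k ≤ ε`. -/
theorem stmt_4 (g gh : ℝ → ℝ)
    (hg0 : ∀ t, 0 ≤ t → 0 ≤ g t)
    (hganti : AntitoneOn g (Set.Ici 0))
    (hgrc : ∀ t, 0 ≤ t → ContinuousWithinAt g (Set.Ici t) t)
    (hglim : Filter.Tendsto g Filter.atTop (nhds 0))
    (hgh0 : ∀ t, 0 ≤ t → 0 ≤ gh t)
    (hghlsc : LowerSemicontinuousOn gh (Set.Ici 0))
    (hghlim : Filter.Tendsto gh Filter.atTop (nhds 0))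
    (ε k : ℝ) (hε : 0 < ε) (hk : 0 < k)
    (hkmin : k < sInf (gh '' Set.Icc 0 (sInf {t : ℝ | 0 ≤ t ∧ g t ≤ ε}))) :
    {t : ℝ | 0 ≤ t ∧ gh t ≤ k}.Nonempty ∧ g (sInf {t : ℝ | 0 ≤ t ∧ gh t ≤ k}) ≤ ε := by
  have hne := hghlim.nonempty_sublevel hk
  have hneg := hglim.nonempty_sublevel hε
  have hT0 : 0 ≤ sInf {t : ℝ | 0 ≤ t ∧ g t ≤ ε} := le_csInf hneg fun t ht => ht.1
  have hle : sInf {t : ℝ | 0 ≤ t ∧ g t ≤ ε} ≤ sInf {t : ℝ | 0 ≤ t ∧ gh t ≤ k} := by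
    refine le_csInf hne fun t ht => ?_
    by_contra! hlt
    have hbdd : BddBelow (gh '' Set.Icc 0 (sInf {t : ℝ | 0 ≤ t ∧ g t ≤ ε})) :=
      ⟨0, Set.forall_mem_image.2 fun s hs => hgh0 s hs.1⟩
    have := csInf_le hbdd (Set.mem_image_of_mem gh ⟨ht.1, hlt.le⟩)
    linarith [ht.2]
  exact ⟨hne, (hganti hT0 (hT0.trans hle) hle).trans (hganti.apply_sInf_sublevel_le hgrc hneg)⟩
end

section
/- Let (Θ, 𝔉, ϑ) be a probability space, ε ∈ ℝ, α ∈ (0,1), δ ∈ (0,1), and c a positive integer. Let K : Θ → ℝ be measurable and let s : Θ × [0,∞) → ℝ be such that for all θ ∈ Θ and κ ≥ 0: s(θ, κ) ≤ ε if and only if κ ≤ K(θ). Let κ̂ : Θ^c → [0,∞) be measurable and suppose that for ϑ^c-almost every sample (θ_1, …, θ_c) the empirical coverage condition (1/c) · #{i ∈ {1, …, c} : s(θ_i, κ̂(θ_1, …, θ_c)) ≤ ε} ≥ 1 − α holds. Then with probability at least 1 − δ over i.i.d. θ_1, …, θ_c ∼ ϑ: ϑ{θ ∈ Θ : s(θ,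 κ̂(θ_1, …, θ_c)) ≤ ε} ≥ 1 − α − √(log(2/δ)/(2c)). -/
open MeasureTheory

open ProbabilityTheory in
/-- One-sided Hoeffding bound for the empirical frequency of a measurable set. -/
theorem measure_pi_frequency_ge_le {Θ : Type*} [MeasurableSpace Θ] (ϑ : Measure Θ)
    [IsProbabilityMeasure ϑ] {c : ℕ} (hc : 0 < c) {A : Set Θ} (hA : MeasurableSet A)
    {t : ℝ} (ht : 0 ≤ t) :
    (Measure.pi fun _ : Fin c => ϑ).real
      {v | c * (ϑ.real A + t) ≤ ({i : Fin c | v i ∈ A}.ncard : ℝ)} ≤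
      Real.exp (-2 * c * t ^ 2) := by
  classical
  set f : Θ → ℝ := A.indicator 1 with hf
  have hfm : Measurable f := measurable_one.indicator hA
  have hint : ϑ[f] = ϑ.real A := integral_indicator_one hA
  have hindep : iIndepFun (fun (i : Fin c) v => f (v i) - ϑ.real A)
      (Measure.pi fun _ : Fin c => ϑ) :=
    iIndepFun_pi (X := fun _ θ => f θ - ϑ.real A) fun _ => (hfm.sub_const _).aemeasurable
  have hsub : ∀ i ∈ (Finset.univ : Finset (Fin c)),
      HasSubgaussianMGF (fun v : Fin c → Θ => f (v i) - ϑ.real A)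
        ((‖(1 : ℝ) - 0‖₊ / 2) ^ 2) (Measure.pi fun _ : Fin c => ϑ) := by
    intro i _
    have h := hasSubgaussianMGF_of_mem_Icc (μ := Measure.pi fun _ : Fin c => ϑ)
      (X := fun v => f (v i)) (a := 0) (b := 1)
      (hfm.comp (measurable_pi_apply i)).aemeasurable
      (ae_of_all _ fun v => by
        by_cases hv : v i ∈ A <;> simp [hf, hv])
    rwa [integral_comp_eval (μ := fun _ : Fin c => ϑ) hfm.aestronglyMeasurable, hint] at h
  have hcard (v : Fin c → Θ) :
      ({i : Fin c | v i ∈ A}.ncard : ℝ) = ∑ i, f (v i) := by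
    simp [hf, Set.indicator_apply, Set.ncard_eq_toFinset_card']
  have hc' : (0 : ℝ) < c := by exact_mod_cast hc
  convert HasSubgaussianMGF.measure_sum_ge_le_of_iIndepFun hindep hsub
    (ε := c * t) (by positivity) using 2
  · ext v
    simp only [Set.mem_ofPred_eq, hcard, Finset.sum_sub_distrib, Finset.sum_const,
      Finset.card_univ, Fintype.card_fin, nsmul_eq_mul, mul_add]
    constructor <;> intro h <;> linarith
  · simp
    field_simp

/-- The upper tail of a finite measure on the line, evaluated at a random point, is stochastically
at least uniform. -/
theorem measure_setOf_measure_Ici_lt_le (ν : Measure ℝ) [IsFiniteMeasure ν] (p : ENNReal) :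
    ν {x | ν (Set.Ici x) < p} ≤ p := by
  have hanti : Antitone fun x => ν (Set.Ici x) :=
    fun _ _ h => measure_mono (Set.Ici_subset_Ici.2 h)
  refine le_of_forall_lt fun r hr => ?_
  obtain ⟨C, hCU, hC, hrC⟩ :=
    (measurableSet_lt hanti.measurable measurable_const).exists_lt_isCompact_of_ne_top
      (measure_ne_top _ _) hr
  obtain ⟨m, hm⟩ := hC.exists_isLeast <| nonempty_of_measure_ne_zero (ne_bot_of_gt hrC)
  exact (hrC.trans_le (measure_mono hm.2)).trans (hCU hm.1)

/-- **Sample-conditional coverage guarantee (DKW/Massart step).**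
Let `(Θ, 𝔉, ϑ)` be a probability space, `ε ∈ ℝ`, `α, δ ∈ (0,1)` and `c` a positive
integer.  Let `K : Θ → ℝ` be measurable and `s : Θ × [0,∞) → ℝ` be such that for all
`θ` and `κ ≥ 0`: `s(θ, κ) ≤ ε ↔ κ ≤ K(θ)`.  Let `κ̂ : Θ^c → [0,∞)` be measurable and
assume that for `ϑ^c`-almost every sample the empirical coverage
`(1/c) #{i : s(θᵢ, κ̂) ≤ ε} ≥ 1 − α` holds.  Then with probability at least `1 − δ`
over i.i.d. `θ_1, …, θ_c ∼ ϑ` (i.e. `ϑ^c` on `Fin c → Θ`),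
`ϑ{θ : s(θ, κ̂(θ_1,…,θ_c)) ≤ ε} ≥ 1 − α − √(log(2/δ)/(2c))`. -/
theorem stmt_9 {Θ : Type*} [MeasurableSpace Θ] (ϑ : Measure Θ) [IsProbabilityMeasure ϑ]
    (ε α δ : ℝ) (hα : α ∈ Set.Ioo (0 : ℝ) 1) (hδ : δ ∈ Set.Ioo (0 : ℝ) 1)
    (c : ℕ) (hc : 0 < c)
    (K : Θ → ℝ) (hK : Measurable K)
    (s : Θ → ℝ → ℝ)
    (hs : ∀ θ (κ : ℝ), 0 ≤ κ → (s θ κ ≤ ε ↔ κ ≤ K θ))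
    (κhat : (Fin c → Θ) → ℝ) (hκmeas : Measurable κhat) (hκ0 : ∀ v, 0 ≤ κhat v)
    (hcov : ∀ᵐ v ∂(Measure.pi fun _ : Fin c => ϑ),
      1 - α ≤ (1 / c : ℝ) * ({i : Fin c | s (v i) (κhat v) ≤ ε}.ncard : ℝ)) :
    1 - δ ≤ ((Measure.pi fun _ : Fin c => ϑ)
      {v | 1 - α - Real.sqrt (Real.log (2 / δ) / (2 * c)) ≤
        (ϑ {θ | s θ (κhat v) ≤ ε}).toReal}).toReal := by
  set t := Real.sqrt (Real.log (2 / δ) / (2 * c)) with ht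
  set p := 1 - α - t with hp
  set P := Measure.pi fun _ : Fin c => ϑ
  have hc' : (0 : ℝ) < c := by exact_mod_cast hc
  have hδ0 : 0 < δ := hδ.1
  have hcover (κ : ℝ) (hκ : 0 ≤ κ) : ϑ {θ | s θ κ ≤ ε} = (ϑ.map K) (Set.Ici κ) := by
    rw [Measure.map_apply hK measurableSet_Ici]
    congr 1 with θ
    exact hs θ κ hκ
  have : IsProbabilityMeasure (ϑ.map K) := Measure.isProbabilityMeasure_map hK.aemeasurable
  have hanti : Antitone fun x => (ϑ.map K) (Set.Ici x) :=
    fun _ _ h => measure_mono (Set.Ici_subset_Ici.2 h)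
  set U : Set ℝ := {x | (ϑ.map K) (Set.Ici x) < ENNReal.ofReal p} with hU
  have hUm : MeasurableSet U := measurableSet_lt hanti.measurable measurable_const
  set A := K ⁻¹' U
  set H : Set (Fin c → Θ) := {v | c * (ϑ.real A + t) ≤ ({i : Fin c | v i ∈ A}.ncard : ℝ)}
  have hH : P.real H ≤ δ := by
    refine (measure_pi_frequency_ge_le ϑ hc (hK hUm) (Real.sqrt_nonneg _)).trans ?_
    have hlog : 0 ≤ Real.log (2 / δ) :=
      Real.log_nonneg ((one_le_div hδ0).2 (by linarith [hδ.2]))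
    have he : -2 * c * t ^ 2 = -Real.log (2 / δ) := by
      rw [ht, Real.sq_sqrt (by positivity)]
      field_simp
    rw [he, Real.exp_neg, Real.exp_log (by positivity), inv_div]
    linarith
  set G : Set (Fin c → Θ) := {v | p ≤ (ϑ {θ | s θ (κhat v) ≤ ε}).toReal}
  have hGH : ∀ᵐ v ∂P, v ∈ G ∪ H := by
    filter_upwards [hcov] with v hv
    refine or_iff_not_imp_left.2 fun hvG => ?_
    replace hvG : (ϑ {θ | s θ (κhat v) ≤ ε}).toReal < p := not_le.1 hvG
    have hp0 : 0 < p := ENNReal.toReal_nonneg.trans_lt hvG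
    have hκU : κhat v ∈ U := by
      rw [hU, Set.mem_ofPred_eq, ← hcover _ (hκ0 v)]
      exact (ENNReal.lt_ofReal_iff_toReal_lt (measure_ne_top _ _)).2 hvG
    have hA : ϑ.real A ≤ p := by
      refine ENNReal.toReal_le_of_le_ofReal hp0.le ?_
      rw [← Measure.map_apply hK hUm]
      exact measure_setOf_measure_Ici_lt_le _ _
    have hsub : {i : Fin c | s (v i) (κhat v) ≤ ε} ⊆ {i | v i ∈ A} := fun i hi =>
      (hanti ((hs _ _ (hκ0 v)).1 hi)).trans_lt hκU
    have hcard : ({i : Fin c | s (v i) (κhat v) ≤ ε}.ncard : ℝ) ≤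
        ({i : Fin c | v i ∈ A}.ncard : ℝ) := by
      exact_mod_cast Set.ncard_le_ncard hsub (Set.toFinite _)
    rw [one_div_mul_eq_div, le_div_iff₀ hc'] at hv
    calc c * (ϑ.real A + t) ≤ c * (p + t) := by gcongr
      _ = (1 - α) * c := by rw [hp]; ring
      _ ≤ _ := hv.trans hcard
  have hunion : P.real (G ∪ H) = 1 := by
    have huniv : (G ∪ H : Set (Fin c → Θ)) =ᵐ[P] Set.univ := Filter.eventuallyEq_univ.2 hGH
    rw [measureReal_def, measure_congr huniv, measure_univ, ENNReal.toReal_one]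
  have hadd : P.real (G ∪ H) ≤ P.real G + P.real H := measureReal_union_le G H
  change 1 - δ ≤ P.real G
  linarith
end
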